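/- arXiv:math/0505455 — 6 statements merged into one kernel-verified Lean document; each statement's English description precedes it below -/
import Mathlib

section
/- For every ε > 0 there exists an integer N such that for all integers h and l with h ≥ l ≥ N, the Hadwiger number of the Cartesian product K_h □ K_l of complete graphs satisfies η(K_h □ K_l) ≥ (1 − ε) · h · √l. -/
open SimpleGraph

/-- `H` is a minor of `G`: there is a family of branch sets in `G`, one for each vertex of `H`,
which are pairwise disjoint, each inducing a connected subgraph of `G`, such that every edge of
`H` is witnessed by an edge of `G` between the corresponding branch sets. -/
def SimpleGraph.IsMinorOf {W V : Type*} (H : SimpleGraph W) (G : SimpleGraph V) : Prop :=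
  ∃ f : W → Set V,
    (∀ w, (G.induce (f w)).Connected) ∧
    (Pairwise fun w w' => Disjoint (f w) (f w')) ∧
    ∀ ⦃w w'⦄, H.Adj w w' → ∃ u ∈ f w, ∃ v ∈ f w', G.Adj u v

/-- The Hadwiger number of `G`: the largest `n` such that `K_n` is a minor of `G`. -/
noncomputable def SimpleGraph.hadwigerNumber {V : Type*} (G : SimpleGraph V) : ℕ :=
  sSup {n : ℕ | (⊤ : SimpleGraph (Fin n)).IsMinorOf G}

namespace SimpleGraph

variable {U V W : Type*}

theorem IsMinorOf.of_injective_hom {H : SimpleGraph W} {G : SimpleGraph U} {G' : SimpleGraph V}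
    (hm : H.IsMinorOf G) (φ : G →g G') (hφ : Function.Injective φ) : H.IsMinorOf G' := by
  obtain ⟨f, hconn, hdisj, hadj⟩ := hm
  refine ⟨fun w => φ '' f w, fun w => ?_, fun w w' hw => ?_, fun w w' hw => ?_⟩
  · exact (hconn w).map (⟨fun x => ⟨φ x, x, x.2, rfl⟩, fun {a b} h => φ.map_adj h⟩ :
      G.induce (f w) →g G'.induce (φ '' f w)) (by rintro ⟨_, x, hx, rfl⟩; exact ⟨⟨x, hx⟩, rfl⟩)
  · exact (Set.disjoint_image_iff hφ).2 (hdisj hw)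
  · obtain ⟨u, hu, v, hv, huv⟩ := hadj hw
    exact ⟨φ u, ⟨u, hu, rfl⟩, φ v, ⟨v, hv, rfl⟩, φ.map_adj huv⟩

theorem IsMinorOf.top_congr {G : SimpleGraph V} (hm : (⊤ : SimpleGraph W).IsMinorOf G)
    (e : U ≃ W) : (⊤ : SimpleGraph U).IsMinorOf G := by
  obtain ⟨f, hconn, hdisj, hadj⟩ := hm
  exact ⟨f ∘ e, fun w => hconn _, fun w w' hw => hdisj (e.injective.ne hw),
    fun w w' hw => hadj (e.injective.ne hw)⟩

theorem IsMinorOf.card_le [Fintype W] [Fintype V] {H : SimpleGraph W} {G : SimpleGraph V}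
    (hm : H.IsMinorOf G) : Fintype.card W ≤ Fintype.card V := by
  obtain ⟨f, hconn, hdisj, -⟩ := hm
  have hne : ∀ w, ∃ v, v ∈ f w := fun w => by
    obtain ⟨v⟩ := (hconn w).nonempty
    exact ⟨v, v.2⟩
  choose g hg using hne
  refine Fintype.card_le_of_injective g fun w w' h => ?_
  by_contra hw
  exact Set.disjoint_left.1 (hdisj hw) (hg w) (h ▸ hg w')

theorem IsMinorOf.card_le_hadwigerNumber [Fintype W] [Fintype V] {G : SimpleGraph V}
    (hm : (⊤ : SimpleGraph W).IsMinorOf G) : Fintype.card W ≤ G.hadwigerNumber := by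
  refine le_csSup ⟨Fintype.card V, fun n hn => ?_⟩ (hm.top_congr (Fintype.equivFin W).symm)
  simpa using hn.card_le

end SimpleGraph

namespace LineMinor

open SimpleGraph

/-- Columns of the host grid: one main column for each slope, class and block, and a pair of
auxiliary columns for each block and residue. -/
abbrev Col (k A T p : ℕ) : Type := (Fin k × Fin A × Fin T) ⊕ ((Fin T × ZMod p) × Bool)

/-- Rows of the host grid: the points of the plane over `ZMod p`, and one meeting row for each
slope and ordered pair of classes. -/
abbrev Row (k A p : ℕ) : Type := (ZMod p × ZMod p) ⊕ (Fin k × Fin A × Fin A)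

/-- The branch set of slope `c`, class `a`, block `t` and intercept `b`: a line in a main column,
linked through one of its points to two auxiliary columns, each of which meets the meeting rows. -/
def branch (k A T p : ℕ) (w : Fin k × Fin A × Fin T × ZMod p) : Set (Col k A T p × Row k A p) :=
  {x | match x with
    | (.inl i, .inl (u, v)) => i = (w.1, w.2.1, w.2.2.1) ∧ v = (w.1 : ℕ) * u + w.2.2.2
    | (.inr ((t, j), _), .inl (u, v)) => t = w.2.2.1 ∧ u = (w.2.1 : ℕ) ∧
        v = (w.1 : ℕ) * u + w.2.2.2 ∧ j = v + (w.1 : ℕ)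
    | (.inr ((t, j), false), .inr (c, a, _)) => t = w.2.2.1 ∧ c = w.1 ∧ a = w.2.1 ∧
        j = (w.1 : ℕ) * ((w.2.1 : ℕ) : ZMod p) + w.2.2.2 + (w.1 : ℕ)
    | (.inr ((t, j), true), .inr (c, _, a)) => t = w.2.2.1 ∧ c = w.1 ∧ a = w.2.1 ∧
        j = (w.1 : ℕ) * ((w.2.1 : ℕ) : ZMod p) + w.2.2.2 + (w.1 : ℕ)
    | _ => False}

theorem branch_connected (k A T p : ℕ) (w : Fin k × Fin A × Fin T × ZMod p) :
    (((⊤ : SimpleGraph (Col k A T p)) □ (⊤ : SimpleGraph (Row k A p))).induce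
      (branch k A T p w)).Connected := by
  obtain ⟨c, a, t, b⟩ := w
  set G := ((⊤ : SimpleGraph (Col k A T p)) □ (⊤ : SimpleGraph (Row k A p))).induce
      (branch k A T p (c, a, t, b)) with hG
  let a' : ZMod p := (a : ℕ)
  let y : ZMod p := (c : ℕ) * a' + b
  let center : branch k A T p (c, a, t, b) :=
    ⟨(.inl (c, a, t), .inl (a', y)), by simp [branch, y, a']⟩
  let link (s : Bool) : branch k A T p (c, a, t, b) :=
    ⟨(.inr ((t, y + (c : ℕ)), s), .inl (a', y)), by simp [branch, y, a']⟩
  have hlink (s : Bool) : G.Reachable center (link s) := by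
    refine Adj.reachable ?_
    simp [hG, center, link, boxProd_adj]
  refine (connected_iff_exists_forall_reachable G).2 ⟨center, ?_⟩
  rintro ⟨⟨i | ⟨⟨t', j⟩, s⟩, ⟨u, v⟩ | ⟨c', a₁, a₂⟩⟩, hx⟩
  · by_cases hu : u = a'
    · have : (⟨(.inl i, .inl (u, v)), hx⟩ : branch k A T p (c, a, t, b)) = center := by
        simp only [branch, Set.mem_ofPred_eq] at hx
        simp [center, hx, hu, y]
      rw [this]
    · refine Adj.reachable ?_
      simp only [branch, Set.mem_ofPred_eq] at hx
      simp [hG, center, boxProd_adj, hx.1, Ne.symm hu]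
  · simp [branch] at hx
  · have : (⟨(.inr ((t', j), s), .inl (u, v)), hx⟩ : branch k A T p (c, a, t, b)) = link s := by
      simp only [branch, Set.mem_ofPred_eq] at hx
      simp [link, hx, y, a']
    rw [this]
    exact hlink s
  · refine (hlink s).trans (Adj.reachable ?_)
    cases s <;> simp only [branch, Set.mem_ofPred_eq] at hx <;>
      simp [hG, link, boxProd_adj, hx, y, a']

theorem natCast_sub_isUnit {k p : ℕ} (hk : ∀ d, 0 < d → d < k → Nat.Coprime d p)
    {c c' : Fin k} (h : c ≠ c') : IsUnit (((c : ℕ) : ZMod p) - (c' : ℕ)) := by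
  wlog hlt : c' < c generalizing c c'
  · rw [← neg_sub, IsUnit.neg_iff]
    exact this h.symm (lt_of_le_of_ne (not_lt.1 hlt) h)
  have hlt' : (c' : ℕ) < c := hlt
  rw [← Nat.cast_sub hlt'.le]
  exact (ZMod.isUnit_iff_coprime _ _).2 (hk _ (by omega) (by omega))

theorem natCast_fin_injective {A p : ℕ} (hA : A ≤ p) :
    Function.Injective fun a : Fin A => ((a : ℕ) : ZMod p) := by
  intro a a' h
  have := (ZMod.natCast_eq_natCast_iff' _ _ _).1 h
  rw [Nat.mod_eq_of_lt (by omega), Nat.mod_eq_of_lt (by omega)] at this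
  exact Fin.ext this

theorem branch_disjoint {k A T p : ℕ} (hkp : k ≤ p) (hAp : A ≤ p)
    {w w' : Fin k × Fin A × Fin T × ZMod p} (hw : w ≠ w') :
    Disjoint (branch k A T p w) (branch k A T p w') := by
  obtain ⟨c, a, t, b⟩ := w
  obtain ⟨c', a', t', b'⟩ := w'
  refine Set.disjoint_left.2 ?_
  rintro ⟨i | ⟨⟨t'', j⟩, s⟩, ⟨u, v⟩ | ⟨c'', a₁, a₂⟩⟩ hx hx' <;> apply hw
  · simp only [branch, Set.mem_ofPred_eq] at hx hx'
    grind
  · simp [branch] at hx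
  · simp only [branch, Set.mem_ofPred_eq] at hx hx'
    have ha : a = a' := natCast_fin_injective hAp (hx.2.1.symm.trans hx'.2.1)
    have hc : c = c' := natCast_fin_injective hkp
      (add_left_cancel (hx.2.2.2.symm.trans hx'.2.2.2))
    grind
  · cases s <;> simp only [branch, Set.mem_ofPred_eq] at hx hx' <;> grind

theorem branch_adj {k A T p : ℕ} (hk : ∀ d, 0 < d → d < k → Nat.Coprime d p)
    (w w' : Fin k × Fin A × Fin T × ZMod p) :
    ∃ x ∈ branch k A T p w, ∃ y ∈ branch k A T p w',
      ((⊤ : SimpleGraph (Col k A T p)) □ (⊤ : SimpleGraph (Row k A p))).Adj x y := by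
  obtain ⟨c, a, t, b⟩ := w
  obtain ⟨c', a', t', b'⟩ := w'
  by_cases h : c = c'
  · subst h
    refine ⟨(.inr ((t, (c : ℕ) * ((a : ℕ) : ZMod p) + b + (c : ℕ)), false), .inr (c, a, a')),
      by simp [branch],
      (.inr ((t', (c : ℕ) * ((a' : ℕ) : ZMod p) + b' + (c : ℕ)), true), .inr (c, a, a')),
      by simp [branch], ?_⟩
    simp [boxProd_adj]
  · obtain ⟨u, hu⟩ := (natCast_sub_isUnit hk h).dvd (a := b' - b)
    refine ⟨(.inl (c, a, t), .inl (u, (c : ℕ) * u + b)), by simp [branch],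
      (.inl (c', a', t'), .inl (u, (c : ℕ) * u + b)), ?_, ?_⟩
    · simp only [branch, Set.mem_ofPred_eq, true_and]
      linear_combination -hu
    · simp [boxProd_adj, h]

theorem isMinorOf {k A T p : ℕ} (hkp : k ≤ p) (hAp : A ≤ p)
    (hk : ∀ d, 0 < d → d < k → Nat.Coprime d p) :
    (⊤ : SimpleGraph (Fin k × Fin A × Fin T × ZMod p)).IsMinorOf
      ((⊤ : SimpleGraph (Col k A T p)) □ (⊤ : SimpleGraph (Row k A p))) :=
  ⟨branch k A T p, branch_connected k A T p, fun _ _ hw => branch_disjoint hkp hAp hw,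
    fun w w' _ => branch_adj hk w w'⟩

theorem le_hadwigerNumber {k A T p h l : ℕ} (hp : 0 < p) (hkp : k ≤ p) (hAp : A ≤ p)
    (hk : ∀ d, 0 < d → d < k → Nat.Coprime d p)
    (hh : k * A * T + 2 * p * T ≤ h) (hl : p ^ 2 + k * A ^ 2 ≤ l) :
    k * A * T * p ≤
      ((⊤ : SimpleGraph (Fin h)) □ (⊤ : SimpleGraph (Fin l))).hadwigerNumber := by
  have : NeZero p := ⟨hp.ne'⟩
  obtain ⟨f⟩ := Function.Embedding.nonempty_of_card_le (α := Col k A T p) (β := Fin h)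
    (by simp [ZMod.card]; linarith)
  obtain ⟨g⟩ := Function.Embedding.nonempty_of_card_le (α := Row k A p) (β := Fin l)
    (by simp [ZMod.card]; linarith)
  have hm := (isMinorOf (T := T) hkp hAp hk).of_injective_hom
    (G' := (⊤ : SimpleGraph (Fin h)) □ (⊤ : SimpleGraph (Fin l)))
    ⟨Prod.map f g, fun {x y} hxy => by simpa [boxProd_adj] using hxy⟩
    (f.injective.prodMap g.injective)
  have := hm.card_le_hadwigerNumber
  simp only [Fintype.card_prod, Fintype.card_fin, ZMod.card] at this
  linarith

end LineMinor

theorem one_sub_div_mul_le_side {r q s : ℝ} (hr : 1 ≤ r) (hq : 0 ≤ q) (hs : 0 ≤ s)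
    (hsq : r * s ≤ (r + 1) * ((r ^ 3 + r + 1) * q)) : (1 - 5 / r) * s ≤ r ^ 3 * q := by
  have hr0 : 0 < r := by linarith
  rcases le_or_gt r 5 with h5 | h5
  · have : 1 - 5 / r ≤ 0 := by
      rw [sub_nonpos, le_div_iff₀ hr0]; linarith
    exact (mul_nonpos_of_nonpos_of_nonneg this hs).trans (by positivity)
  · have h6 : (r - 5) * ((r + 1) * (r ^ 3 + r + 1)) ≤ r ^ 2 * r ^ 3 := by
      nlinarith [pow_pos hr0 4, pow_pos hr0 3, pow_pos hr0 2]
    have h7 : r ^ 2 * ((1 - 5 / r) * s) = (r - 5) * (r * s) := by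
      field_simp
    have h8 : (r - 5) * (r * s) ≤ r ^ 2 * (r ^ 3 * q) := by
      calc (r - 5) * (r * s) ≤ (r - 5) * ((r + 1) * ((r ^ 3 + r + 1) * q)) :=
            mul_le_mul_of_nonneg_left hsq (by linarith)
        _ = (r - 5) * ((r + 1) * (r ^ 3 + r + 1)) * q := by ring
        _ ≤ r ^ 2 * r ^ 3 * q := by gcongr
        _ = _ := by ring
    exact le_of_mul_le_mul_left (h7.trans_le h8) (by positivity)

theorem one_sub_div_mul_le_columns {r q C T h : ℝ} (hr : 1 ≤ r) (hq : 0 ≤ q) (hT : 0 ≤ T)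
    (hh : 0 ≤ h) (hCq : C ≤ (r ^ 4 + 2 * r ^ 3 + 2) * q)
    (hCh : r * C ≤ h) (hTh : h ≤ C * T + C) : (1 - 5 / r) * h ≤ r ^ 4 * q * T := by
  have hr0 : 0 < r := by linarith
  rcases le_or_gt r 4 with h4 | h4
  · have : 1 - 5 / r ≤ 0 := by
      rw [sub_nonpos, le_div_iff₀ hr0]; linarith
    exact (mul_nonpos_of_nonpos_of_nonneg this hh).trans (by positivity)
  · have h5 : (r - 1) * h ≤ r * (C * T) := by nlinarith
    have h6 : (r - 4) * (r ^ 4 + 2 * r ^ 3 + 2) ≤ r * r ^ 4 := by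
      nlinarith [pow_pos hr0 4, pow_pos hr0 3, mul_pos hr0 (pow_pos hr0 2),
        one_le_pow₀ hr (n := 2)]
    have h7 : (r - 4) * C ≤ r * (r ^ 4 * q) := by
      calc (r - 4) * C ≤ (r - 4) * ((r ^ 4 + 2 * r ^ 3 + 2) * q) :=
            mul_le_mul_of_nonneg_left hCq (by linarith)
        _ = (r - 4) * (r ^ 4 + 2 * r ^ 3 + 2) * q := by ring
        _ ≤ r * r ^ 4 * q := by gcongr
        _ = _ := by ring
    have h8 : r ^ 2 * ((1 - 5 / r) * h) = (r * (r - 5)) * h := by field_simp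
    have h9 : (r * (r - 5)) * h ≤ r ^ 2 * (r ^ 4 * q * T) := by
      calc (r * (r - 5)) * h ≤ ((r - 4) * (r - 1)) * h := by gcongr ?_ * _; linarith
        _ = (r - 4) * ((r - 1) * h) := by ring
        _ ≤ (r - 4) * (r * (C * T)) := mul_le_mul_of_nonneg_left h5 (by linarith)
        _ = (r - 4) * C * (r * T) := by ring
        _ ≤ r * (r ^ 4 * q) * (r * T) := by gcongr
        _ = _ := by ring
    exact le_of_mul_le_mul_left (h8.trans_le h9) (by positivity)

theorem one_sub_div_mul_mul_le {r h s x y : ℝ} (hr : 0 < r) (hh : 0 ≤ h) (hs : 0 ≤ s)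
    (hx : 0 ≤ x) (hy : 0 ≤ y) (hhx : (1 - 5 / r) * h ≤ x) (hsy : (1 - 5 / r) * s ≤ y) :
    (1 - 10 / r) * h * s ≤ x * y := by
  have h10 : 10 / r = 2 * (5 / r) := by ring
  rcases le_or_gt r 5 with h5 | h5
  · have : 1 - 10 / r ≤ 0 := by
      rw [sub_nonpos, le_div_iff₀ hr]; linarith
    exact (mul_nonpos_of_nonpos_of_nonneg
      (mul_nonpos_of_nonpos_of_nonneg this hh) hs).trans (mul_nonneg hx hy)
  · have h6 : 0 ≤ 1 - 5 / r := by
      rw [sub_nonneg, div_le_iff₀ hr]; linarith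
    have h7 : 1 - 10 / r ≤ (1 - 5 / r) * (1 - 5 / r) := by
      rw [h10]; linarith [mul_self_nonneg (5 / r)]
    calc (1 - 10 / r) * h * s ≤ (1 - 5 / r) * (1 - 5 / r) * h * s := by gcongr
      _ = ((1 - 5 / r) * h) * ((1 - 5 / r) * s) := by ring
      _ ≤ x * y := mul_le_mul hhx hsy (mul_nonneg h6 hs) hx

theorem hadwigerNumber_boxProd_ge {r h l : ℕ} (hr : 1 ≤ r) (hlh : l ≤ h)
    (hl : ((r ^ 3 + r + 1) * (r ^ 4).factorial * r) ^ 2 ≤ l) :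
    (1 - 10 / (r : ℝ)) * h * Real.sqrt l ≤
      (((⊤ : SimpleGraph (Fin h)) □ (⊤ : SimpleGraph (Fin l))).hadwigerNumber : ℝ) := by
  set B := r ^ 3 + r + 1 with hB
  set F := (r ^ 4).factorial with hF
  have hF0 : 0 < F := Nat.factorial_pos _
  have hBF : 0 < B * F := by positivity
  set M := Nat.sqrt l / (B * F) with hM
  have hrM : r ≤ M := by
    rw [hM, Nat.le_div_iff_mul_le hBF, Nat.le_sqrt']
    linarith
  set q := F * M with hq
  have hrq : r ≤ q := hrM.trans (Nat.le_mul_of_pos_left _ hF0)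
  have hq1 : 1 ≤ q := hr.trans hrq
  have hBq : B * q ≤ Nat.sqrt l := by
    rw [hq, ← mul_assoc]
    exact Nat.mul_div_le _ _
  have hBql : (B * q) ^ 2 ≤ l := Nat.le_sqrt'.1 hBq
  set p := r ^ 3 * q + 1 with hp
  set C := r ^ 4 * q + 2 * p with hC
  have hC0 : 0 < C := by positivity
  set T := h / C with hT
  have hFq : F ≤ q := Nat.le_mul_of_pos_right _ (by omega)
  have hqp : q ≤ p := by
    have : 1 ≤ r ^ 3 := Nat.one_le_pow _ _ hr
    nlinarith
  have hkp : r ^ 4 ≤ p := ((Nat.self_le_factorial _).trans hFq).trans hqp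
  have hcop : ∀ d, 0 < d → d < r ^ 4 → Nat.Coprime d p := by
    intro d hd hd'
    have hdq : d ∣ r ^ 3 * q :=
      ((Nat.dvd_factorial hd hd'.le).trans (Dvd.intro _ rfl)).trans (Dvd.intro_left _ rfl)
    obtain ⟨e, he⟩ := hdq
    rw [hp, he]
    simp
  have hcols : r ^ 4 * q * T + 2 * p * T ≤ h := by
    rw [← add_mul]
    exact Nat.mul_div_le _ _
  have hrows : p ^ 2 + r ^ 4 * q ^ 2 ≤ l := by
    refine le_trans ?_ hBql
    have : p ≤ (r ^ 3 + 1) * q := by rw [hp]; linarith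
    calc p ^ 2 + r ^ 4 * q ^ 2 ≤ ((r ^ 3 + 1) * q) ^ 2 + r ^ 4 * q ^ 2 := by gcongr
      _ ≤ (B * q) ^ 2 := by rw [hB]; ring_nf; nlinarith
  have key := LineMinor.le_hadwigerNumber (T := T) (by omega) hkp hqp hcop hcols hrows
  refine le_trans ?_ (Nat.cast_le (α := ℝ).2 key)
  have hr' : (1 : ℝ) ≤ r := by exact_mod_cast hr
  have hr0 : (0 : ℝ) < r := by linarith
  have hq' : (1 : ℝ) ≤ q := by exact_mod_cast hq1
  have hside : (1 - 5 / (r : ℝ)) * Real.sqrt l ≤ p := by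
    have h1 : Real.sqrt l ≤ B * F * (M + 1) := by
      have h2 : Nat.sqrt l < B * F * (M + 1) := by
        rw [hM]; exact Nat.lt_mul_div_succ _ hBF
      calc Real.sqrt l ≤ Nat.sqrt l + 1 := Real.real_sqrt_le_nat_sqrt_succ
        _ ≤ _ := by exact_mod_cast h2
    have h3 : r * Real.sqrt l ≤ (r + 1) * (B * q) := by
      have hrM' : (r : ℝ) ≤ M := by exact_mod_cast hrM
      calc r * Real.sqrt l ≤ r * (B * F * (M + 1)) := by gcongr
        _ = B * F * (r * M + r) := by ring
        _ ≤ B * F * (r * M + M) := by gcongr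
        _ = _ := by rw [hq]; push_cast; ring
    have h4 := one_sub_div_mul_le_side hr' (Nat.cast_nonneg q) (Real.sqrt_nonneg l)
      (by rw [hB] at h3; push_cast at h3; exact h3)
    rw [hp]; push_cast; linarith
  have hmain : (1 - 5 / (r : ℝ)) * h ≤ r ^ 4 * q * T := by
    have hCq : (C : ℝ) ≤ (r ^ 4 + 2 * r ^ 3 + 2) * q := by
      rw [hC, hp]; push_cast; linarith
    have hCh : r * (C : ℝ) ≤ h := by
      have h1 : ((B : ℝ) * q) ^ 2 ≤ h := by exact_mod_cast hBql.trans hlh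
      have h2 : (r ^ 4 + 2 * r ^ 3 + 2 : ℝ) ≤ B ^ 2 := by
        rw [hB]; push_cast; nlinarith [pow_pos hr0 6, pow_pos hr0 4, pow_pos hr0 3]
      calc r * (C : ℝ) ≤ q * ((r ^ 4 + 2 * r ^ 3 + 2) * q) := by gcongr
        _ ≤ q * (B ^ 2 * q) := by gcongr
        _ = (B * q) ^ 2 := by ring
        _ ≤ h := h1
    have hTh : (h : ℝ) ≤ C * T + C := by
      have : h < C * (T + 1) := Nat.lt_mul_div_succ _ hC0
      have : (h : ℝ) ≤ C * (T + 1) := by exact_mod_cast this.le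
      linarith
    exact one_sub_div_mul_le_columns hr' (Nat.cast_nonneg q) (Nat.cast_nonneg T)
      (Nat.cast_nonneg h) hCq hCh hTh
  push_cast
  exact one_sub_div_mul_mul_le hr0 (Nat.cast_nonneg h) (Real.sqrt_nonneg l) (by positivity)
    (Nat.cast_nonneg p) hmain hside

theorem stmt_0 :
    ∀ ε : ℝ, 0 < ε → ∃ N : ℕ, ∀ h l : ℕ, l ≤ h → N ≤ l →
      (1 - ε) * (h : ℝ) * Real.sqrt l ≤
        (((⊤ : SimpleGraph (Fin h)) □ (⊤ : SimpleGraph (Fin l))).hadwigerNumber : ℝ) := by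
  intro ε hε
  obtain ⟨r, hr⟩ := exists_nat_gt (10 / ε)
  have hr0 : (0 : ℝ) < r := (by positivity : 0 < 10 / ε).trans hr
  have hr1 : 1 ≤ r := by exact_mod_cast hr0
  refine ⟨_, fun h l hlh hl => le_trans ?_ (hadwigerNumber_boxProd_ge hr1 hlh hl)⟩
  gcongr
  exact ((div_lt_comm₀ hε hr0).1 hr).le
end

section
/- For all integers n ≥ m ≥ 2, the Hadwiger number of the Cartesian product of complete graphs satisfies η(K_n □ K_m) ≤ n·√m + m; that is, if K_h is a minor of K_n □ K_m then h ≤ n·√m + m. -/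
open SimpleGraph

namespace SimpleGraph

/-- If an induced subgraph on `s` is connected, every nonempty proper subset of `s` has an edge
leaving it inside `s`. -/
theorem exists_adj_of_induce_connected {V : Type*} {G : SimpleGraph V} {s t : Set V}
    (hs : (G.induce s).Connected) (hts : t ⊂ s) (ht : t.Nonempty) :
    ∃ x ∈ t, ∃ y ∈ s \ t, G.Adj x y := by
  obtain ⟨x, hx⟩ := ht
  obtain ⟨y, hys, hyt⟩ := Set.exists_of_ssubset hts
  obtain ⟨p⟩ := hs.preconnected ⟨x, hts.1 hx⟩ ⟨y, hys⟩
  obtain ⟨d, -, hd₁, hd₂⟩ := p.exists_boundary_dart {v | v.1 ∈ t} hx hyt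
  exact ⟨d.fst.1, hd₁, d.snd.1, ⟨d.snd.2, hd₂⟩, d.adj⟩

section Rook

variable {α β : Type*} [Fintype α] [Fintype β] [DecidableEq α] [DecidableEq β]

/-- The union of all horizontal and vertical lines of the grid `α × β` that meet `s`. -/
def lineUnion (s : Finset (α × β)) : Finset (α × β) :=
  {p | ∃ q ∈ s, p.1 = q.1 ∨ p.2 = q.2}

theorem mem_lineUnion {s : Finset (α × β)} {p : α × β} :
    p ∈ lineUnion s ↔ ∃ q ∈ s, p.1 = q.1 ∨ p.2 = q.2 := by
  simp [lineUnion]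

theorem card_lineUnion_singleton_le (q : α × β) :
    (lineUnion {q}).card ≤ Fintype.card α + Fintype.card β := by
  have hsub : lineUnion {q} ⊆ Finset.univ ×ˢ {q.2} ∪ {q.1} ×ˢ Finset.univ := by
    intro p
    simp only [mem_lineUnion, Finset.mem_singleton, exists_eq_left, Finset.mem_union,
      Finset.mem_product, Finset.mem_univ, true_and, and_true]
    exact Or.symm
  refine (Finset.card_le_card hsub).trans ((Finset.card_union_le _ _).trans ?_)
  simp

theorem card_lineUnion_insert_le (hcard : Fintype.card β ≤ Fintype.card α)
    {s : Finset (α × β)} {x y : α × β} (hx : x ∈ s)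
    (hxy : ((⊤ : SimpleGraph α) □ (⊤ : SimpleGraph β)).Adj x y) :
    (lineUnion (insert y s)).card ≤ (lineUnion s).card + Fintype.card α := by
  rw [boxProd_adj] at hxy
  rcases hxy with ⟨-, h⟩ | ⟨-, h⟩
  · have hsub : lineUnion (insert y s) ⊆ lineUnion s ∪ {y.1} ×ˢ Finset.univ := by
      intro p
      simp only [mem_lineUnion, Finset.mem_union, Finset.mem_product, Finset.mem_singleton,
        Finset.mem_univ, and_true]
      rintro ⟨q, hq, hpq⟩
      rcases Finset.mem_insert.1 hq with rfl | hq
      · exact hpq.symm.imp (fun e => ⟨x, hx, .inr (e.trans h.symm)⟩) id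
      · exact .inl ⟨q, hq, hpq⟩
    refine (Finset.card_le_card hsub).trans ((Finset.card_union_le _ _).trans ?_)
    simpa using hcard
  · have hsub : lineUnion (insert y s) ⊆ lineUnion s ∪ Finset.univ ×ˢ {y.2} := by
      intro p
      simp only [mem_lineUnion, Finset.mem_union, Finset.mem_product, Finset.mem_singleton,
        Finset.mem_univ, true_and]
      rintro ⟨q, hq, hpq⟩
      rcases Finset.mem_insert.1 hq with rfl | hq
      · exact hpq.imp (fun e => ⟨x, hx, .inl (e.trans h.symm)⟩) id
      · exact .inl ⟨q, hq, hpq⟩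
    refine (Finset.card_le_card hsub).trans ((Finset.card_union_le _ _).trans ?_)
    simp

/-- A connected set of `k` vertices meets lines covering at most `k * |α| + |β|` vertices, since
adding a vertex adjacent to the set creates at most one new line. -/
theorem card_lineUnion_le_of_connected (hcard : Fintype.card β ≤ Fintype.card α)
    {s : Finset (α × β)}
    (hs : (((⊤ : SimpleGraph α) □ (⊤ : SimpleGraph β)).induce (s : Set (α × β))).Connected) :
    (lineUnion s).card ≤ s.card * Fintype.card α + Fintype.card β := by
  obtain ⟨⟨q, hq⟩⟩ := hs.nonempty
  let good : Finset (Finset (α × β)) := s.powerset.filter fun t =>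
    t.Nonempty ∧ (lineUnion t).card ≤ t.card * Fintype.card α + Fintype.card β
  have hgood : good.Nonempty := by
    refine ⟨{q}, ?_⟩
    simp only [good, Finset.mem_filter, Finset.mem_powerset, Finset.singleton_subset_iff,
      Finset.singleton_nonempty, true_and, Finset.card_singleton, one_mul]
    exact ⟨hq, card_lineUnion_singleton_le q⟩
  obtain ⟨t, ht, hmax⟩ := good.exists_max_image Finset.card hgood
  obtain ⟨hts, hne, hle⟩ : t ⊆ s ∧ t.Nonempty ∧
      (lineUnion t).card ≤ t.card * Fintype.card α + Fintype.card β := by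
    simpa [good] using ht
  rcases hts.eq_or_ssubset with rfl | hss
  · exact hle
  obtain ⟨x, hx, y, ⟨hys, hyt⟩, hxy⟩ :=
    exists_adj_of_induce_connected hs (Finset.coe_ssubset.2 hss) hne
  have hins : (insert y t).card = t.card + 1 := Finset.card_insert_of_notMem hyt
  have hmem : insert y t ∈ good := by
    simp only [good, Finset.mem_filter, Finset.mem_powerset, Finset.insert_subset_iff,
      Finset.insert_nonempty, true_and, hins, add_mul, one_mul]
    refine ⟨⟨hys, hts⟩, ?_⟩
    have := card_lineUnion_insert_le hcard hx hxy
    lia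
  have := hmax _ hmem
  lia

/-- A complete minor of order `h > 0` has a branch set of order `k ≤ |α| |β| / h`, and every
branch set meets the lines through it. -/
theorem exists_le_of_top_isMinorOf_boxProd (hcard : Fintype.card β ≤ Fintype.card α) {h : ℕ}
    (hpos : 0 < h)
    (hminor : (⊤ : SimpleGraph (Fin h)).IsMinorOf ((⊤ : SimpleGraph α) □ (⊤ : SimpleGraph β))) :
    ∃ k : ℕ, h * k ≤ Fintype.card α * Fintype.card β ∧
      h ≤ k * Fintype.card α + Fintype.card β := by
  classical
  obtain ⟨f, hconn, hdisj, hadj⟩ := hminor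
  let g : Fin h → Finset (α × β) := fun w => (f w).toFinset
  have hgdisj : Pairwise fun w w' => Disjoint (g w) (g w') := fun w w' hw =>
    Set.disjoint_toFinset.2 (hdisj hw)
  obtain ⟨w, -, hmin⟩ := (Finset.univ : Finset (Fin h)).exists_min_image (fun w => (g w).card)
    ⟨⟨0, hpos⟩, Finset.mem_univ _⟩
  refine ⟨(g w).card, ?_, ?_⟩
  · calc h * (g w).card ≤ ∑ w', (g w').card := by
          simpa using Finset.card_nsmul_le_sum Finset.univ (fun w' => (g w').card) _ hmin
      _ = (Finset.univ.biUnion g).card :=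
          (Finset.card_biUnion fun a _ b _ hab => hgdisj hab).symm
      _ ≤ Fintype.card α * Fintype.card β := by
          simpa using Finset.card_le_univ (Finset.univ.biUnion g)
  · have hmeet : ∀ w', ∃ p ∈ g w', p ∈ lineUnion (g w) := by
      intro w'
      by_cases hw : w = w'
      · subst hw
        obtain ⟨⟨q, hq⟩⟩ := (hconn w).nonempty
        exact ⟨q, by simpa [g] using hq, mem_lineUnion.2 ⟨q, by simpa [g] using hq, .inl rfl⟩⟩
      · obtain ⟨u, hu, v, hv, huv⟩ := hadj ((top_adj w w').2 hw)
        refine ⟨v, by simpa [g] using hv, mem_lineUnion.2 ⟨u, by simpa [g] using hu, ?_⟩⟩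
        rw [boxProd_adj] at huv
        exact huv.symm.imp (fun e => e.2.symm) (fun e => e.2.symm)
    choose p hpg hpU using hmeet
    have hinj : Function.Injective p := by
      intro a b hab
      by_contra hne
      exact Finset.disjoint_left.1 (hgdisj hne) (hpg a) (hab ▸ hpg b)
    have hle : h ≤ (lineUnion (g w)).card := by
      simpa using Finset.card_le_card_of_injOn (s := Finset.univ) p (fun a _ => hpU a)
        hinj.injOn
    refine hle.trans (card_lineUnion_le_of_connected hcard ?_)
    rw [Set.coe_toFinset]
    exact hconn w

end Rook

/-- The quadratic estimate `h * (h - m) ≤ n² m` in solved form. -/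
theorem le_mul_sqrt_add_of_top_isMinorOf_boxProd {n m h : ℕ} (hnm : m ≤ n)
    (hminor : (⊤ : SimpleGraph (Fin h)).IsMinorOf
      ((⊤ : SimpleGraph (Fin n)) □ (⊤ : SimpleGraph (Fin m)))) :
    (h : ℝ) ≤ (n : ℝ) * Real.sqrt m + m := by
  rcases h.eq_zero_or_pos with rfl | hpos
  · simp only [Nat.cast_zero]
    positivity
  obtain ⟨k, hk₁, hk₂⟩ := exists_le_of_top_isMinorOf_boxProd
    (by simpa only [Fintype.card_fin] using hnm) hpos hminor
  simp only [Fintype.card_fin] at hk₁ hk₂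
  have hk₁' : (h : ℝ) * k ≤ n * m := by exact_mod_cast hk₁
  have hk₂' : (h : ℝ) ≤ k * n + m := by exact_mod_cast hk₂
  have hquad : (h : ℝ) * (h - m) ≤ (n * Real.sqrt m) * (n * Real.sqrt m) :=
    calc (h : ℝ) * (h - m) ≤ h * (k * n) := by gcongr; linarith
      _ = h * k * n := by ring
      _ ≤ n * m * n := by gcongr
      _ = n * n * (Real.sqrt m * Real.sqrt m) := by
          rw [Real.mul_self_sqrt (Nat.cast_nonneg m)]; ring
      _ = (n * Real.sqrt m) * (n * Real.sqrt m) := by ring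
  by_contra! hlt
  have hr : 0 ≤ (n : ℝ) * Real.sqrt m := by positivity
  have hm : (0 : ℝ) ≤ m := Nat.cast_nonneg m
  exact hquad.not_gt (mul_lt_mul'' (by linarith) (by linarith) hr hr)

end SimpleGraph

theorem stmt_3 (n m : ℕ) (hm : 2 ≤ m) (hnm : m ≤ n) :
    (((⊤ : SimpleGraph (Fin n)) □ (⊤ : SimpleGraph (Fin m))).hadwigerNumber : ℝ) ≤
        (n : ℝ) * Real.sqrt m + m ∧
      ∀ h : ℕ, (⊤ : SimpleGraph (Fin h)).IsMinorOf
          ((⊤ : SimpleGraph (Fin n)) □ (⊤ : SimpleGraph (Fin m))) →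
        (h : ℝ) ≤ (n : ℝ) * Real.sqrt m + m := by
  have hbound := fun h : ℕ => le_mul_sqrt_add_of_top_isMinorOf_boxProd (h := h) hnm
  refine ⟨?_, hbound⟩
  rw [← Nat.le_floor_iff (by positivity)]
  refine csSup_le ⟨0, fun w => w.elim0, fun w => w.elim0, fun w => w.elim0, fun w => w.elim0⟩ ?_
  exact fun h hh => Nat.le_floor (hbound h hh)
end

section
/- Every finite simple graph G with chromatic number χ(G) = k has the graph W_k as a minor. -/
open SimpleGraph

/-- The graph `W n` on `{0, 1, …, n-1}`: for `i < j`, vertices `i` and `j` are adjacent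
iff `i = 0` or `j = i + 1` (a path on `n` vertices whose first vertex `0` is additionally
adjacent to all other vertices). -/
def W (n : ℕ) : SimpleGraph (Fin n) :=
  SimpleGraph.fromRel (fun i j => i.val = 0 ∨ j.val = i.val + 1)

/-- A graph that is not `m`-colorable has a nonempty vertex set inducing a subgraph of minimum
degree at least `m`. -/
theorem SimpleGraph.exists_finset_le_card_neighbors_of_not_colorable {V : Type*} [Fintype V]
    {G : SimpleGraph V} {m : ℕ} (h : ¬ G.Colorable m) :
    ∃ s : Finset V, s.Nonempty ∧
      ∀ v ∈ s, ∃ t ⊆ s, m ≤ t.card ∧ ∀ w ∈ t, G.Adj v w := by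
  classical
  by_contra! hs
  have key : ∀ n, ∀ s : Finset V, s.card = n → ∃ c : V → ℕ, (∀ v ∈ s, c v < m) ∧
      ∀ v ∈ s, ∀ w ∈ s, G.Adj v w → c v ≠ c w := by
    intro n
    induction n with
    | zero =>
      intro s h0
      rw [Finset.card_eq_zero] at h0
      subst h0
      exact ⟨fun _ => 0, by simp, by simp⟩
    | succ n ih =>
      intro s hn
      obtain ⟨v, hv, hdeg⟩ := hs s (Finset.card_pos.1 (by omega))
      obtain ⟨c, hc, hadj⟩ := ih (s.erase v) (by rw [Finset.card_erase_of_mem hv]; omega)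
      have hlt : (s.filter (G.Adj v)).card < m := by
        by_contra! hle
        obtain ⟨w, hw, hvw⟩ := hdeg _ (Finset.filter_subset (G.Adj v) s) hle
        exact hvw (Finset.mem_filter.1 hw).2
      obtain ⟨a, ha, ha'⟩ : ∃ a ∈ Finset.range m, a ∉ (s.filter (G.Adj v)).image c :=
        Finset.exists_mem_notMem_of_card_lt_card
          (by rw [Finset.card_range]; exact Finset.card_image_le.trans_lt hlt)
      rw [Finset.mem_range] at ha
      have hav : ∀ w ∈ s, G.Adj v w → c w ≠ a := fun w hw hvw hwa =>
        ha' (Finset.mem_image.2 ⟨w, Finset.mem_filter.2 ⟨hw, hvw⟩, hwa⟩)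
      refine ⟨Function.update c v a, fun w hw => ?_, fun x hx y hy hxy => ?_⟩
      · by_cases hwv : w = v
        · simpa [hwv] using ha
        · simpa [hwv] using hc w (Finset.mem_erase.2 ⟨hwv, hw⟩)
      · by_cases hxv : x = v
        · subst hxv
          simpa [hxy.ne'] using (hav y hy hxy).symm
        · by_cases hyv : y = v
          · subst hyv
            simpa [hxv] using hav x hx hxy.symm
          · simpa [hxv, hyv] using
              hadj x (Finset.mem_erase.2 ⟨hxv, hx⟩) y (Finset.mem_erase.2 ⟨hyv, hy⟩) hxy
  obtain ⟨c, hc, hadj⟩ := key _ Finset.univ rfl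
  exact h ⟨Coloring.mk (fun v => ⟨c v, hc v (Finset.mem_univ v)⟩) fun {v w} hvw heq =>
    hadj v (Finset.mem_univ v) w (Finset.mem_univ w) hvw (congrArg Fin.val heq)⟩

/-- In a nonempty finite vertex set there is a path whose first vertex has all its neighbors
within the set on the path. -/
theorem SimpleGraph.exists_path_neighbors_subset {V : Type*} [Fintype V] (G : SimpleGraph V)
    {s : Finset V} (hs : s.Nonempty) :
    ∃ (n : ℕ) (u : ℕ → V), (∀ i ≤ n, u i ∈ s) ∧ Set.InjOn u (Set.Iic n) ∧
      (∀ i < n, G.Adj (u i) (u (i + 1))) ∧ ∀ w ∈ s, G.Adj (u 0) w → ∃ i ≤ n, u i = w := by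
  classical
  let P : ℕ → Prop := fun n => ∃ u : ℕ → V, (∀ i ≤ n, u i ∈ s) ∧ Set.InjOn u (Set.Iic n) ∧
    ∀ i < n, G.Adj (u i) (u (i + 1))
  have hzero : P 0 := by
    obtain ⟨v, hv⟩ := hs
    exact ⟨fun _ => v, fun _ _ => hv, fun i hi j hj _ =>
      (Nat.le_zero.1 hi).trans (Nat.le_zero.1 hj).symm, by simp⟩
  have hcard : ¬ P (Fintype.card V) := by
    rintro ⟨u, -, hu, -⟩
    have := Finset.card_le_card_of_injOn (s := Finset.Iic (Fintype.card V)) (t := Finset.univ) u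
      (by simp) (by simpa using hu)
    simp at this
  obtain ⟨n, ⟨u, hus, hinj, hadj⟩, hn⟩ : ∃ n, P n ∧ ¬ P (n + 1) := by
    by_contra! hstep
    exact hcard (Nat.rec (motive := P) hzero hstep _)
  refine ⟨n, u, hus, hinj, hadj, fun w hw huw => ?_⟩
  by_contra! hnot
  refine hn ⟨fun i => Nat.casesOn i w u, ?_, ?_, ?_⟩
  · rintro (_ | i) hi
    · exact hw
    · exact hus i (by omega)
  · rintro (_ | i) hi (_ | j) hj hij
    · rfl
    · exact absurd hij.symm (hnot j (by simpa using hj))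
    · exact absurd hij (hnot i (by simpa using hi))
    · exact congrArg (· + 1) (hinj (by simpa using hi) (by simpa using hj) hij)
  · rintro (_ | i) hi
    · exact huw.symm
    · exact hadj i (by omega)

/-- The vertices at an interval of positions along a walk induce a connected subgraph. -/
theorem SimpleGraph.induce_image_connected {V : Type*} {G : SimpleGraph V} {u : ℕ → V}
    {I : Set ℕ} (hne : I.Nonempty) (hI : I.OrdConnected)
    (hadj : ∀ i ∈ I, i + 1 ∈ I → G.Adj (u i) (u (i + 1))) :
    (G.induce (u '' I)).Connected := by
  have key : ∀ (d i : ℕ) (hi : i ∈ I) (hd : i + d ∈ I), (G.induce (u '' I)).Reachable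
      ⟨u i, Set.mem_image_of_mem u hi⟩ ⟨u (i + d), Set.mem_image_of_mem u hd⟩ := by
    intro d
    induction d with
    | zero => exact fun i hi hd => Reachable.refl _
    | succ d ih =>
      intro i hi hd
      have hmem : i + d ∈ I := hI.out hi hd ⟨by omega, by omega⟩
      refine (ih i hi hmem).trans (Adj.reachable ?_)
      exact hadj (i + d) hmem hd
  obtain ⟨i₀, hi₀⟩ := hne
  have : Nonempty (u '' I) := ⟨⟨u i₀, Set.mem_image_of_mem u hi₀⟩⟩
  refine ⟨?_⟩
  rintro ⟨_, i, hi, rfl⟩ ⟨_, j, hj, rfl⟩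
  rcases le_total i j with h | h
  · obtain ⟨d, rfl⟩ := Nat.exists_eq_add_of_le h
    exact key d i hi hj
  · obtain ⟨d, rfl⟩ := Nat.exists_eq_add_of_le h
    exact (key d j hj hi).symm

/-- If the first vertex of a path has at least `m` neighbors on the path, then `W (m + 1)` is a
minor: cut the path just before each neighbor of its first vertex. -/
theorem W_isMinorOf_of_path {V : Type*} {G : SimpleGraph V} {n m : ℕ} {u : ℕ → V}
    (hinj : Set.InjOn u (Set.Iic n)) (hadj : ∀ i < n, G.Adj (u i) (u (i + 1)))
    {t : Finset V} (ht : m ≤ t.card) (htu : ∀ w ∈ t, G.Adj (u 0) w ∧ ∃ i ≤ n, u i = w) :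
    (W (m + 1)).IsMinorOf G := by
  classical
  let p : ℕ → Prop := fun i => G.Adj (u 0) (u i)
  let g : ℕ → ℕ := fun i => Nat.count p (i + 1)
  have hg0 : g 0 = 0 := by simp [g, p, Nat.count_succ]
  have hmono : Monotone g := fun i j hij => Nat.count_monotone p (by omega)
  have hgsucc : ∀ i, g (i + 1) = g i + if p (i + 1) then 1 else 0 :=
    fun i => Nat.count_succ p (i + 1)
  have hgn : m ≤ g n := by
    have hsub : t ⊆ ((Finset.range (n + 1)).filter p).image u := by
      intro w hw
      obtain ⟨hw', i, hi, rfl⟩ := htu w hw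
      exact Finset.mem_image_of_mem u (Finset.mem_filter.2 ⟨Finset.mem_range.2 (by omega), hw'⟩)
    calc m ≤ t.card := ht
      _ ≤ _ := Finset.card_le_card hsub
      _ ≤ _ := Finset.card_image_le
      _ = g n := (Nat.count_eq_card_filter_range p (n + 1)).symm
  have hjump : ∀ j < m, ∃ i < n, g i = j ∧ g (i + 1) = j + 1 ∧ p (i + 1) := by
    intro j hj
    have hex : ∃ i, j < g i := ⟨n, by omega⟩
    obtain ⟨i, hi⟩ : ∃ i, Nat.find hex = i + 1 := Nat.exists_eq_succ_of_ne_zero fun h0 => by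
      have := Nat.find_spec hex
      rw [h0] at this
      omega
    have hlt : j < g (i + 1) := hi ▸ Nat.find_spec hex
    have hle : ¬ j < g i := Nat.find_min hex (by omega)
    have hin : Nat.find hex ≤ n := Nat.find_min' hex (by omega)
    have hs := hgsucc i
    by_cases hp : p (i + 1)
    · rw [if_pos hp] at hs
      exact ⟨i, by omega, by omega, by omega, hp⟩
    · rw [if_neg hp] at hs
      omega
  let I : ℕ → Set ℕ := fun j => {i | i ≤ n ∧ g i = j}
  have hedge : ∀ a b : Fin (m + 1), a ≠ b → (a.val = 0 ∨ b.val = a.val + 1) →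
      ∃ x ∈ u '' I a, ∃ y ∈ u '' I b, G.Adj x y := by
    rintro ⟨a, ha⟩ ⟨b, hb⟩ hne hab
    simp only [ne_eq, Fin.mk.injEq] at hne hab
    obtain ⟨j, rfl⟩ : ∃ j, b = j + 1 := Nat.exists_eq_succ_of_ne_zero (by omega)
    obtain ⟨i, hi, hgi, hgi', hp⟩ := hjump j (by omega)
    rcases hab with rfl | hab
    · exact ⟨_, ⟨0, ⟨by omega, hg0⟩, rfl⟩, _, ⟨i + 1, ⟨hi, hgi'⟩, rfl⟩, hp⟩
    · exact ⟨_, ⟨i, ⟨by omega, by simp only; omega⟩, rfl⟩, _, ⟨i + 1, ⟨hi, hgi'⟩, rfl⟩, hadj i hi⟩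
  refine ⟨fun j => u '' I j, fun j => induce_image_connected ?_ ⟨?_⟩ ?_, ?_, ?_⟩
  · obtain ⟨j, hj⟩ := j
    rcases j with _ | j
    · exact ⟨0, by omega, hg0⟩
    · obtain ⟨i, hi, -, hgi, -⟩ := hjump j (by omega)
      exact ⟨i + 1, hi, hgi⟩
  · rintro a ⟨_, ha⟩ b ⟨hb, hb'⟩ c ⟨hac, hcb⟩
    have h1 := hmono hac
    have h2 := hmono hcb
    exact ⟨hcb.trans hb, by omega⟩
  · rintro i - ⟨hi, -⟩
    exact hadj i hi
  · intro a b hab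
    refine Set.disjoint_left.2 ?_
    rintro _ ⟨i, ⟨hi, hia⟩, rfl⟩ ⟨i', ⟨hi', hib⟩, heq⟩
    have := hinj hi' hi heq
    subst this
    exact hab (Fin.ext (hia.symm.trans hib))
  · intro a b hab
    rw [W, fromRel_adj] at hab
    obtain ⟨hne, h | h⟩ := hab
    · exact hedge a b hne h
    · obtain ⟨x, hx, y, hy, hxy⟩ := hedge b a hne.symm h
      exact ⟨y, hy, x, hx, hxy.symm⟩

theorem stmt_8 (V : Type) [Fintype V] (G : SimpleGraph V) (k : ℕ)
    (hk : G.chromaticNumber = (k : ℕ∞)) :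
    (W k).IsMinorOf G := by
  rcases k with _ | m
  · exact ⟨fun _ => ∅, fun w => w.elim0, fun w => w.elim0, fun w => w.elim0⟩
  · have hcol : ¬ G.Colorable m := fun h => by
      have hle := h.chromaticNumber_le
      rw [hk, Nat.cast_le] at hle
      omega
    obtain ⟨s, hs, hdeg⟩ := exists_finset_le_card_neighbors_of_not_colorable hcol
    obtain ⟨n, u, hus, hinj, hadj, hmax⟩ := G.exists_path_neighbors_subset hs
    obtain ⟨t, hts, htm, hut⟩ := hdeg (u 0) (hus 0 n.zero_le)
    exact W_isMinorOf_of_path hinj hadj htm fun w hw => ⟨hut w hw, hmax w (hts hw) (hut w hw)⟩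
end

section
/- For every integer n ≥ 1, the complete graph K_n is a minor of the Cartesian product W_n □ W_n. -/
open SimpleGraph

/-- Vertex `0` of `W (m + 1)` is adjacent to every other vertex. -/
lemma W_adj_zero {m : ℕ} {i : Fin (m + 1)} (hi : i ≠ 0) : (W (m + 1)).Adj i 0 := by
  simp [W, hi]

/-- Away from row `0`, a vertex of the product is owned by its row;
a vertex of row `0` is owned by its column. -/
def cliqueOwner {m : ℕ} (p : Fin (m + 1) × Fin (m + 1)) : Fin (m + 1) :=
  if p.1 = 0 then p.2 else p.1

lemma cliqueOwner_row {m : ℕ} {i : Fin (m + 1)} (hi : i ≠ 0) (j : Fin (m + 1)) :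
    cliqueOwner (i, j) = i := if_neg hi

lemma cliqueOwner_zero {m : ℕ} (j : Fin (m + 1)) : cliqueOwner (0, j) = j := if_pos rfl

lemma cliqueOwner_hub {m : ℕ} (i : Fin (m + 1)) : cliqueOwner (i, 0) = i := by
  by_cases hi : i = 0 <;> simp [cliqueOwner, hi]

lemma connected_induce_cliqueOwner {m : ℕ} (w : Fin (m + 1)) :
    ((W (m + 1) □ W (m + 1)).induce (cliqueOwner ⁻¹' {w})).Connected := by
  rw [connected_iff_exists_forall_reachable]
  refine ⟨⟨(w, 0), cliqueOwner_hub w⟩, ?_⟩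
  have row (j : Fin (m + 1)) (hj : cliqueOwner (w, j) = w) :
      ((W (m + 1) □ W (m + 1)).induce (cliqueOwner ⁻¹' {w})).Reachable
        ⟨(w, 0), cliqueOwner_hub w⟩ ⟨(w, j), hj⟩ := by
    by_cases h : j = 0
    · subst h
      rfl
    · refine Adj.reachable ?_
      simpa [boxProd_adj] using (W_adj_zero h).symm
  rintro ⟨⟨i, j⟩, hp⟩
  by_cases hi : i = 0
  · subst hi
    obtain rfl : j = w := (cliqueOwner_zero j).symm.trans hp
    by_cases hj : j = 0
    · subst hj
      rfl
    · refine (row j (cliqueOwner_row hj j)).trans (Adj.reachable ?_)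
      simpa [boxProd_adj] using W_adj_zero hj
  · obtain rfl : i = w := (cliqueOwner_row hi j).symm.trans hp
    exact row j hp

theorem stmt_9 (n : ℕ) (hn : 1 ≤ n) :
    (⊤ : SimpleGraph (Fin n)).IsMinorOf (W n □ W n) := by
  obtain ⟨m, rfl⟩ := Nat.exists_eq_add_of_le' hn
  refine ⟨fun w => cliqueOwner ⁻¹' {w}, connected_induce_cliqueOwner, ?_, ?_⟩
  · intro w w' h
    exact Disjoint.preimage _ (Set.disjoint_singleton.2 h)
  · intro i j h
    by_cases hi : i = 0
    · subst hi
      refine ⟨(0, 0), cliqueOwner_zero 0, (j, 0), cliqueOwner_hub j, ?_⟩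
      simpa [boxProd_adj] using (W_adj_zero h.ne').symm
    · refine ⟨(i, j), cliqueOwner_row hi j, (0, j), cliqueOwner_zero j, ?_⟩
      simpa [boxProd_adj] using W_adj_zero hi
end

section
/- Let G and H be finite simple graphs with χ(G) = χ(H). Then the Cartesian product G □ H satisfies Hadwiger's conjecture, i.e. η(G □ H) ≥ χ(G □ H). -/
open SimpleGraph

theorem SimpleGraph.colorable_of_forall_ncard_neighborSet_lt {V : Type*} [Finite V]
    {G : SimpleGraph V} {k : ℕ} (hG : ∀ v, (G.neighborSet v).ncard < k) : G.Colorable k := by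
  classical
  have := Fintype.ofFinite V
  rcases isEmpty_or_nonempty V with hV | ⟨⟨v₀⟩⟩
  · exact .of_isEmpty k
  suffices h : ∀ s : Finset V, ∃ c : V → Fin k,
      ∀ u ∈ s, ∀ v ∈ s, G.Adj u v → c u ≠ c v by
    obtain ⟨c, hc⟩ := h Finset.univ
    exact ⟨Coloring.mk c fun {u v} huv => hc u (Finset.mem_univ u) v (Finset.mem_univ v) huv⟩
  intro s
  induction s using Finset.induction_on with
  | empty => exact ⟨fun _ => ⟨0, (Nat.zero_le _).trans_lt (hG v₀)⟩, by simp⟩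
  | insert a s ha ih =>
    obtain ⟨c, hc⟩ := ih
    obtain ⟨x, hx⟩ : ∃ x, x ∉ c '' G.neighborSet a := by
      by_contra! h
      have h₁ : (c '' G.neighborSet a).ncard ≤ (G.neighborSet a).ncard := Set.ncard_image_le
      rw [Set.eq_univ_of_forall h, Set.ncard_univ, Nat.card_fin] at h₁
      exact absurd (hG a) h₁.not_gt
    have hx' : ∀ v, G.Adj a v → c v ≠ x := fun v hv h => hx ⟨v, hv, h⟩
    have hs : ∀ v ∈ s, v ≠ a := fun v hv h => ha (h ▸ hv)
    refine ⟨Function.update c a x, fun u hu' v hv' huv => ?_⟩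
    rcases Finset.mem_insert.1 hu' with rfl | hu <;> rcases Finset.mem_insert.1 hv' with rfl | hv
    · exact absurd huv (G.loopless.irrefl _)
    · simpa [hs v hv] using (hx' v huv).symm
    · simpa [hs u hu] using hx' u huv.symm
    · simpa [hs u hu, hs v hv] using hc u hu v hv huv

theorem SimpleGraph.exists_embedding_neighborSet_of_not_colorable {V : Type*} [Finite V]
    {G : SimpleGraph V} {k : ℕ} (hG : ¬ G.Colorable k) :
    ∃ v, Nonempty (Fin k ↪ G.neighborSet v) := by
  classical
  have := Fintype.ofFinite V
  obtain ⟨v, hv⟩ : ∃ v, k ≤ (G.neighborSet v).ncard := by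
    by_contra! h
    exact hG (colorable_of_forall_ncard_neighborSet_lt h)
  refine ⟨v, Function.Embedding.nonempty_of_card_le ?_⟩
  rwa [Fintype.card_fin, ← Nat.card_eq_fintype_card]

theorem SimpleGraph.Colorable.boxProd {V W : Type*} {G : SimpleGraph V} {H : SimpleGraph W}
    {k : ℕ} (hG : G.Colorable k) (hH : H.Colorable k) : (G □ H).Colorable k := by
  cases k with
  | zero =>
    rw [colorable_zero_iff] at hG ⊢
    exact ⟨fun p => hG.false p.1⟩
  | succ k =>
    obtain ⟨c⟩ := hG
    obtain ⟨d⟩ := hH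
    refine ⟨Coloring.mk (fun p => c p.1 + d p.2) fun {p q} hpq => ?_⟩
    rcases boxProd_adj.1 hpq with ⟨h, e⟩ | ⟨h, e⟩
    · simpa [e] using c.valid h
    · simpa [e] using d.valid h

theorem SimpleGraph.le_hadwigerNumber {V : Type*} [Finite V] {G : SimpleGraph V} {n : ℕ}
    (h : (⊤ : SimpleGraph (Fin n)).IsMinorOf G) : n ≤ G.hadwigerNumber := by
  refine le_csSup ⟨Nat.card V, ?_⟩ h
  rintro m ⟨f, hconn, hdisj, -⟩
  have hne : ∀ i, (f i).Nonempty := fun i => Set.nonempty_coe_sort.1 (hconn i).nonempty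
  choose g hg using hne
  have hinj : Function.Injective g := fun i j hij => by
    by_contra hne
    exact Set.disjoint_left.1 (hdisj hne) (hg i) (hij ▸ hg j)
  simpa using Nat.card_le_card_of_injective g hinj

/-- The product of two stars with `m` leaves has a `K_{m+1}` minor: the branch
sets are the centre `(a, b)` and, for each `i`, the set of all `(x i, b)`, `(x i, y j)` and
`(a, y i)`. -/
theorem SimpleGraph.top_isMinorOf_boxProd {V W : Type*} {G : SimpleGraph V} {H : SimpleGraph W}
    {m : ℕ} {a : V} {b : W} (x : Fin m ↪ G.neighborSet a) (y : Fin m ↪ H.neighborSet b) :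
    (⊤ : SimpleGraph (Fin (m + 1))).IsMinorOf (G □ H) := by
  have hx : ∀ i, G.Adj a (x i) := fun i => (x i).2
  have hy : ∀ i, H.Adj b (y i) := fun i => (y i).2
  have hxi : ∀ i j, (x i : V) = x j → i = j := fun i j h => x.injective (Subtype.ext h)
  have hyi : ∀ i j, (y i : W) = y j → i = j := fun i j h => y.injective (Subtype.ext h)
  let B : Fin m → Set (V × W) := fun i =>
    {p | p = (↑(x i), b) ∨ (∃ j, p = (↑(x i), ↑(y j))) ∨ p = (a, ↑(y i))}
  have hBx : ∀ i, ((x i : V), b) ∈ B i := fun i => Or.inl rfl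
  have hBxy : ∀ i j, ((x i : V), (y j : W)) ∈ B i := fun i j => Or.inr (Or.inl ⟨j, rfl⟩)
  have hBy : ∀ i, (a, (y i : W)) ∈ B i := fun i => Or.inr (Or.inr rfl)
  have hconn : ∀ i, ((G □ H).induce (B i)).Connected := by
    intro i
    have hxy : ∀ j, ((G □ H).induce (B i)).Reachable ⟨_, hBx i⟩ ⟨_, hBxy i j⟩ := fun j =>
      Adj.reachable (by simp [boxProd_adj, hy])
    refine connected_iff_exists_forall_reachable _ |>.2 ⟨⟨_, hBx i⟩, ?_⟩
    rintro ⟨p, rfl | ⟨j, rfl⟩ | rfl⟩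
    · exact .rfl
    · exact hxy j
    · exact (hxy i).trans (Adj.reachable (by simp [boxProd_adj, (hx i).symm]))
  have hcentre : ∀ i, (a, b) ∉ B i := by
    rintro i (h | ⟨j, h⟩ | h) <;> rw [Prod.mk.injEq] at h
    · exact (hx i).ne h.1
    · exact (hx i).ne h.1
    · exact (hy i).ne h.2
  have hdisj : ∀ i j, i ≠ j → Disjoint (B i) (B j) := by
    intro i j hij
    rw [Set.disjoint_left]
    rintro p (rfl | ⟨k, rfl⟩ | rfl) (h | ⟨l, h⟩ | h) <;> rw [Prod.mk.injEq] at h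
    · exact hij (hxi _ _ h.1)
    · exact hij (hxi _ _ h.1)
    · exact (hx i).ne h.1.symm
    · exact hij (hxi _ _ h.1)
    · exact hij (hxi _ _ h.1)
    · exact (hx i).ne h.1.symm
    · exact (hx j).ne h.1
    · exact (hx j).ne h.1
    · exact hij (hyi _ _ h.2)
  refine ⟨Fin.cons {(a, b)} B, fun i => ?_, fun i j hij => ?_, fun i j hij => ?_⟩
  · cases i using Fin.cases with
    | zero =>
      change ((G □ H).induce {(a, b)}).Connected
      exact .of_subsingleton
    | succ i => exact hconn i
  · cases i using Fin.cases with
    | zero =>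
      cases j using Fin.cases with
      | zero => exact absurd rfl hij
      | succ j => exact Set.disjoint_singleton_left.2 (hcentre j)
    | succ i =>
      cases j using Fin.cases with
      | zero => exact Set.disjoint_singleton_right.2 (hcentre i)
      | succ j => exact hdisj i j fun h => hij (congrArg Fin.succ h)
  · cases i using Fin.cases with
    | zero =>
      cases j using Fin.cases with
      | zero => exact absurd rfl hij.ne
      | succ j => exact ⟨_, rfl, _, hBx j, by simp [boxProd_adj, hx]⟩
    | succ i =>
      cases j using Fin.cases with
      | zero => exact ⟨_, hBx i, _, rfl, by simp [boxProd_adj, (hx i).symm]⟩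
      | succ j => exact ⟨_, hBxy i j, _, hBy j, by simp [boxProd_adj, (hx i).symm]⟩

theorem stmt_10 (V₁ V₂ : Type) [Fintype V₁] [Fintype V₂]
    (G : SimpleGraph V₁) (H : SimpleGraph V₂)
    (hchi : G.chromaticNumber = H.chromaticNumber) :
    (G □ H).chromaticNumber ≤ ((G □ H).hadwigerNumber : ℕ∞) := by
  obtain ⟨n, hn⟩ := ENat.ne_top_iff_exists.1
    (chromaticNumber_ne_top_iff_exists.2 ⟨_, G.colorable_of_fintype⟩)
  have hG : ∀ k : ℕ, G.Colorable k ↔ n ≤ k := fun k => by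
    rw [← chromaticNumber_le_iff_colorable, ← hn, Nat.cast_le]
  have hH : ∀ k : ℕ, H.Colorable k ↔ n ≤ k := fun k => by
    rw [← chromaticNumber_le_iff_colorable, ← hchi, ← hn, Nat.cast_le]
  refine (((hG n).2 le_rfl).boxProd ((hH n).2 le_rfl)).chromaticNumber_le.trans ?_
  rw [Nat.cast_le]
  cases n with
  | zero => exact Nat.zero_le _
  | succ m =>
    obtain ⟨a, ⟨x⟩⟩ := exists_embedding_neighborSet_of_not_colorable
      (mt (hG m).1 (Nat.not_succ_le_self m))
    obtain ⟨b, ⟨y⟩⟩ := exists_embedding_neighborSet_of_not_colorable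
      (mt (hH m).1 (Nat.not_succ_le_self m))
    exact le_hadwigerNumber (top_isMinorOf_boxProd x y)
end

section
/- If M₁ is a minor of G₁ and M₂ is a minor of G₂, then the Cartesian product M₁ □ M₂ is a minor of G₁ □ G₂. -/
open SimpleGraph

/-- The Cartesian product of two induced subgraphs is the subgraph of the Cartesian product
induced by the product set. -/
def SimpleGraph.boxProdInduceIso {V W : Type*} (G : SimpleGraph V) (H : SimpleGraph W)
    (s : Set V) (t : Set W) :
    (G.induce s □ H.induce t) ≃g (G □ H).induce (s ×ˢ t) where
  toEquiv := (Equiv.Set.prod s t).symm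
  map_rel_iff' {a b} := by
    simp only [boxProd_adj, comap_adj, Subtype.ext_iff]
    rfl

theorem stmt_13 {α₁ α₂ β₁ β₂ : Type*}
    (G₁ : SimpleGraph α₁) (G₂ : SimpleGraph α₂)
    (M₁ : SimpleGraph β₁) (M₂ : SimpleGraph β₂)
    (h₁ : M₁.IsMinorOf G₁) (h₂ : M₂.IsMinorOf G₂) :
    (M₁ □ M₂).IsMinorOf (G₁ □ G₂) := by
  obtain ⟨f₁, hconn₁, hdisj₁, hadj₁⟩ := h₁
  obtain ⟨f₂, hconn₂, hdisj₂, hadj₂⟩ := h₂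
  refine ⟨fun w => f₁ w.1 ×ˢ f₂ w.2, fun w => ?_, fun w w' hne => ?_, ?_⟩
  · exact (boxProdInduceIso G₁ G₂ (f₁ w.1) (f₂ w.2)).connected_iff.mp
      ((hconn₁ w.1).boxProd (hconn₂ w.2))
  · refine Set.disjoint_prod.mpr ?_
    by_cases h : w.1 = w'.1
    · exact .inr (hdisj₂ fun h' => hne (Prod.ext h h'))
    · exact .inl (hdisj₁ h)
  · rintro ⟨a, b⟩ ⟨a', b'⟩ (⟨hadj, rfl : b = b'⟩ | ⟨hadj, rfl : a = a'⟩)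
    · obtain ⟨u, hu, v, hv, huv⟩ := hadj₁ hadj
      obtain ⟨x, hx⟩ := (hconn₂ b).nonempty
      exact ⟨(u, x), ⟨hu, hx⟩, (v, x), ⟨hv, hx⟩, .inl ⟨huv, rfl⟩⟩
    · obtain ⟨u, hu, v, hv, huv⟩ := hadj₂ hadj
      obtain ⟨x, hx⟩ := (hconn₁ a).nonempty
      exact ⟨(x, u), ⟨hx, hu⟩, (x, v), ⟨hx, hv⟩, .inr ⟨huv, rfl⟩⟩
end
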